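/- arXiv:0903.0344 — 9 statements merged into one kernel-verified Lean document; each statement's English description precedes it below -/
import Mathlib

section
/- In the algebra C, the left annihilator of (the image of) the generator n is zero: for every c ∈ C, if c·n = 0 then c = 0. -/
noncomputable section

open FreeAlgebra

/-- Generators of the algebra `C`: `n, p, q, r, s, t, u, v, w`,
`x_1, …, x_{m-2}`, `y_1, …, y_{m-3}`, `z_1, …, z_{m-4}`. -/
inductive CGen (m : ℕ) : Type
  | n | p | q | r | s | t | u | v | w
  | x (i : ℕ) (h1 : 1 ≤ i) (h2 : i ≤ m - 2)
  | y (i : ℕ) (h1 : 1 ≤ i) (h2 : i ≤ m - 3)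
  | z (i : ℕ) (h1 : 1 ≤ i) (h2 : i ≤ m - 4)

/-- The defining relations of `C`, as a relation on the free algebra
(each generator `g` of the ideal contributes the pair `(g, 0)`). -/
inductive CRel (k : Type) [Field k] (m : ℕ) :
    FreeAlgebra k (CGen m) → FreeAlgebra k (CGen m) → Prop
  | np_nq : CRel k m (ι k CGen.n * ι k CGen.p - ι k CGen.n * ι k CGen.q) 0
  | np_nr : CRel k m (ι k CGen.n * ι k CGen.p - ι k CGen.n * ι k CGen.r) 0
  | ps_pt : CRel k m (ι k CGen.p * ι k CGen.s - ι k CGen.p * ι k CGen.t) 0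
  | qt_qu : CRel k m (ι k CGen.q * ι k CGen.t - ι k CGen.q * ι k CGen.u) 0
  | rs_ru : CRel k m (ι k CGen.r * ι k CGen.s - ι k CGen.r * ι k CGen.u) 0
  | sv_sw : CRel k m (ι k CGen.s * ι k CGen.v - ι k CGen.s * ι k CGen.w) 0
  | tw_tx (h : 1 ≤ m - 2) :
      CRel k m (ι k CGen.t * ι k CGen.w - ι k CGen.t * ι k (CGen.x 1 le_rfl h)) 0
  | uv_ux (h : 1 ≤ m - 2) :
      CRel k m (ι k CGen.u * ι k CGen.v - ι k CGen.u * ι k (CGen.x 1 le_rfl h)) 0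
  | vx2 (h : 2 ≤ m - 2) :
      CRel k m (ι k CGen.v * ι k (CGen.x 2 (by omega) h)) 0
  | wx2 (h : 2 ≤ m - 2) :
      CRel k m (ι k CGen.w * ι k (CGen.x 2 (by omega) h)) 0
  | sv_sy (h : 1 ≤ m - 3) :
      CRel k m (ι k CGen.s * ι k CGen.v - ι k CGen.s * ι k (CGen.y 1 le_rfl h)) 0
  | tw_ty (h : 1 ≤ m - 3) :
      CRel k m (ι k CGen.t * ι k CGen.w - ι k CGen.t * ι k (CGen.y 1 le_rfl h)) 0
  | ux_uy (h2 : 1 ≤ m - 2) (h3 : 1 ≤ m - 3) :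
      CRel k m (ι k CGen.u * ι k (CGen.x 1 le_rfl h2) -
        ι k CGen.u * ι k (CGen.y 1 le_rfl h3)) 0
  | sz (h : 1 ≤ m - 4) : CRel k m (ι k CGen.s * ι k (CGen.z 1 le_rfl h)) 0
  | tz (h : 1 ≤ m - 4) : CRel k m (ι k CGen.t * ι k (CGen.z 1 le_rfl h)) 0
  | uz (h : 1 ≤ m - 4) : CRel k m (ι k CGen.u * ι k (CGen.z 1 le_rfl h)) 0
  | xx (i : ℕ) (h1 : 1 ≤ i) (h2 : i ≤ m - 3) :
      CRel k m (ι k (CGen.x i h1 (by omega)) *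
        ι k (CGen.x (i + 1) (by omega) (by omega))) 0
  | yx_zy (i : ℕ) (h1 : 2 ≤ i) (h2 : i ≤ m - 3) :
      CRel k m (ι k (CGen.y (i - 1) (by omega) (by omega)) *
          ι k (CGen.x i (by omega) (by omega)) +
        ι k (CGen.z (i - 1) (by omega) (by omega)) * ι k (CGen.y i (by omega) h2)) 0
  | zz (i : ℕ) (h1 : 1 ≤ i) (h2 : i ≤ m - 5) :
      CRel k m (ι k (CGen.z i h1 (by omega)) *
        ι k (CGen.z (i + 1) (by omega) (by omega))) 0

/-- The algebra `C`: the quotient of the free algebra by the two-sided ideal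
generated by the relations. -/
abbrev Calg (k : Type) [Field k] (m : ℕ) : Type := RingQuot (CRel k m)

/-- The image in `C` of a generator. -/
def cgen (k : Type) [Field k] (m : ℕ) (g : CGen m) : Calg k m :=
  RingQuot.mkAlgHom k (CRel k m) (ι k g)

def cn (k : Type) [Field k] (m : ℕ) : Calg k m := cgen k m CGen.n
def cp (k : Type) [Field k] (m : ℕ) : Calg k m := cgen k m CGen.p
def cq (k : Type) [Field k] (m : ℕ) : Calg k m := cgen k m CGen.q
def cr (k : Type) [Field k] (m : ℕ) : Calg k m := cgen k m CGen.r
def cs (k : Type) [Field k] (m : ℕ) : Calg k m := cgen k m CGen.s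
def ct (k : Type) [Field k] (m : ℕ) : Calg k m := cgen k m CGen.t
def cu (k : Type) [Field k] (m : ℕ) : Calg k m := cgen k m CGen.u
def cv (k : Type) [Field k] (m : ℕ) : Calg k m := cgen k m CGen.v
def cw (k : Type) [Field k] (m : ℕ) : Calg k m := cgen k m CGen.w
def cx (k : Type) [Field k] (m : ℕ) (i : ℕ) (h1 : 1 ≤ i) (h2 : i ≤ m - 2) : Calg k m :=
  cgen k m (CGen.x i h1 h2)
def cy (k : Type) [Field k] (m : ℕ) (i : ℕ) (h1 : 1 ≤ i) (h2 : i ≤ m - 3) : Calg k m :=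
  cgen k m (CGen.y i h1 h2)
def cz (k : Type) [Field k] (m : ℕ) (i : ℕ) (h1 : 1 ≤ i) (h2 : i ≤ m - 4) : Calg k m :=
  cgen k m (CGen.z i h1 h2)

/-- Coefficient of `n` in a generator: `1` at `n` and `0` elsewhere. -/
def nCoeff (k : Type) [Field k] (m : ℕ) : CGen m → Calg k m
  | CGen.n => 1
  | _ => 0

/-- The matrix `(a, ∂a; 0, ε a)` at a generator `a`, where `ε` is the augmentation and `∂` is
the right Fox derivative with respect to `n`. -/
def foxGen (k : Type) [Field k] (m : ℕ) (g : CGen m) : Matrix (Fin 2) (Fin 2) (Calg k m) :=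
  !![cgen k m g, nCoeff k m g; 0, 0]

lemma foxGen_mul_foxGen (k : Type) [Field k] (m : ℕ) (g h : CGen m) :
    foxGen k m g * foxGen k m h = !![cgen k m g * cgen k m h, cgen k m g * nCoeff k m h; 0, 0] := by
  ext i j; fin_cases i <;> fin_cases j <;> simp [foxGen]

lemma lift_foxGen_of_rel (k : Type) [Field k] (m : ℕ) {a b : FreeAlgebra k (CGen m)}
    (hab : CRel k m a b) :
    FreeAlgebra.lift k (foxGen k m) a = FreeAlgebra.lift k (foxGen k m) b := by
  have key := RingQuot.mkAlgHom_rel k hab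
  cases hab <;>
    simp only [map_sub, map_add, map_mul, map_zero] at key <;>
    simp only [map_sub, map_add, map_mul, map_zero, FreeAlgebra.lift_ι_apply,
      foxGen_mul_foxGen, nCoeff, mul_zero, cgen] <;>
    ext i j <;> fin_cases i <;> fin_cases j <;> simp [key]

/-- The Fox derivative with respect to `n`, as a triangular matrix representation of `C`. -/
def foxHom (k : Type) [Field k] (m : ℕ) : Calg k m →ₐ[k] Matrix (Fin 2) (Fin 2) (Calg k m) :=
  RingQuot.liftAlgHom k ⟨FreeAlgebra.lift k (foxGen k m), fun _ _ h => lift_foxGen_of_rel k m h⟩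

lemma foxHom_cgen (k : Type) [Field k] (m : ℕ) (g : CGen m) :
    foxHom k m (cgen k m g) = foxGen k m g := by
  simp [foxHom, cgen]

lemma foxHom_apply_zero (k : Type) [Field k] (m : ℕ) (c : Calg k m) :
    foxHom k m c 0 0 = c ∧ foxHom k m c 1 0 = 0 := by
  obtain ⟨a, rfl⟩ := RingQuot.mkAlgHom_surjective k (CRel k m) c
  induction a using FreeAlgebra.induction with
  | grade0 r => simp [AlgHom.commutes, Matrix.algebraMap_matrix_apply]
  | grade1 g =>
    change foxHom k m (cgen k m g) 0 0 = cgen k m g ∧ foxHom k m (cgen k m g) 1 0 = 0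
    simp [foxHom_cgen, foxGen]
  | mul a b ha hb => simp [Matrix.mul_apply, Fin.sum_univ_two, ha, hb]
  | add a b ha hb => simp [ha, hb]

/-- In the algebra `C`, the left annihilator of (the image of) the
generator `n` is zero: for every `c ∈ C`, if `c·n = 0` then `c = 0`. -/
theorem stmt0 (k : Type) [Field k] (m : ℕ) (hm : 5 ≤ m) :
    ∀ c : Calg k m, c * cn k m = 0 → c = 0 := by
  intro c hc
  have h : foxHom k m (c * cn k m) 0 1 = c := by
    simp [cn, foxHom_cgen, foxGen, nCoeff, Matrix.mul_apply, Fin.sum_univ_two,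
      foxHom_apply_zero]
  rw [← h, hc, map_zero, Matrix.zero_apply]
end
end

section
/- In the algebra C, the left annihilator of the element np is zero: for every c ∈ C, if c·(np) = 0 then c = 0. (Equivalently, the row matrix λ_m = (0,0,0,0,np,np,−np) has zero left annihilator.) -/
noncomputable section

open FreeAlgebra

namespace CGen

/-- The value of a generator in an upper triangular representation of `C` over itself: the
`(0, 0)` entry is the tautological one, the `(1, 1)` entry is the character supported on `p, q, r`,
and the `(0, 1)` entry is the skew derivation supported on `n`. -/
def triangular (k : Type) [Field k] (m : ℕ) : CGen m → Matrix (Fin 2) (Fin 2) (Calg k m)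
  | .n => !![cgen k m .n, 1; 0, 0]
  | .p => !![cgen k m .p, 0; 0, 1]
  | .q => !![cgen k m .q, 0; 0, 1]
  | .r => !![cgen k m .r, 0; 0, 1]
  | g => !![cgen k m g, 0; 0, 0]

end CGen

namespace Calg

variable (k : Type) [Field k] (m : ℕ)

theorem mkAlgHom_eq_zero {a : FreeAlgebra k (CGen m)} (h : CRel k m a 0) :
    RingQuot.mkAlgHom k (CRel k m) a = 0 := by
  simpa using RingQuot.mkAlgHom_rel k h

theorem lift_triangular_rel ⦃a b : FreeAlgebra k (CGen m)⦄ (h : CRel k m a b) :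
    FreeAlgebra.lift k (CGen.triangular k m) a = FreeAlgebra.lift k (CGen.triangular k m) b := by
  have hb : b = 0 := by cases h <;> rfl
  subst hb
  have h0 := mkAlgHom_eq_zero k m h
  rw [map_zero]
  cases h <;>
    simpa [CGen.triangular, ← Matrix.ext_iff, Fin.forall_fin_two, Matrix.mul_apply, cgen] using h0

/-- The upper triangular representation of `C` over itself. -/
def triangularRep : Calg k m →ₐ[k] Matrix (Fin 2) (Fin 2) (Calg k m) :=
  RingQuot.liftAlgHom k
    ⟨FreeAlgebra.lift k (CGen.triangular k m), lift_triangular_rel k m⟩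

theorem triangularRep_cgen (g : CGen m) :
    triangularRep k m (cgen k m g) = CGen.triangular k m g := by
  simp [triangularRep, cgen]

theorem triangularRep_col_zero (c : Calg k m) :
    triangularRep k m c 0 0 = c ∧ triangularRep k m c 1 0 = 0 := by
  obtain ⟨a, rfl⟩ := RingQuot.mkAlgHom_surjective k (CRel k m) c
  induction a using FreeAlgebra.induction with
  | grade0 a => simp [AlgHom.commutes, Matrix.algebraMap_matrix_apply]
  | grade1 g =>
    change triangularRep k m (cgen k m g) 0 0 = cgen k m g ∧
      triangularRep k m (cgen k m g) 1 0 = 0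
    rw [triangularRep_cgen]
    cases g <;> simp [CGen.triangular]
  | mul a b ha hb => simp [Matrix.mul_apply, ha, hb]
  | add a b ha hb => simp [ha, hb]

theorem triangularRep_mul_np (c : Calg k m) :
    triangularRep k m (c * (cn k m * cp k m)) 0 1 = c := by
  simp [cn, cp, triangularRep_cgen, CGen.triangular, Matrix.mul_apply,
    (triangularRep_col_zero k m c).1]

end Calg

/-- In the algebra `C`, the left annihilator of the element `np`
is zero: for every `c ∈ C`, if `c·(np) = 0` then `c = 0`. -/
theorem stmt1 (k : Type) [Field k] (m : ℕ) (hm : 5 ≤ m) :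
    ∀ c : Calg k m, c * (cn k m * cp k m) = 0 → c = 0 := by
  intro c hc
  rw [← Calg.triangularRep_mul_np k m c, hc, map_zero, Matrix.zero_apply]
end
end

section
/- In the algebra C, the left annihilator of the matrix α is zero: the left C-module map C³ → C⁶ sending (e₁,e₂,e₃) to (e₁p, e₂q, e₃r, −e₁p − e₃r, e₁p − e₂q, e₂q + e₃r) (right multiplication by the matrix α' with rows (p,0,0,−p,p,0), (0,q,0,0,−q,q), (0,0,r,−r,0,r)) is injective. -/
noncomputable section

open FreeAlgebra

/-- The indicator of the generators `p`, `q`, `r`. -/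
def pqrIndicator (k : Type) [Field k] (m : ℕ) : CGen m → Calg k m
  | .p | .q | .r => 1
  | _ => 0

/-- The value on generators of the representation `deletionHom`. -/
def deletionMatrix (k : Type) [Field k] (m : ℕ) (g : CGen m) :
    Matrix (Fin 2) (Fin 2) (Calg k m) :=
  !![cgen k m g, pqrIndicator k m g; 0, 0]

lemma deletionMatrix_mul (k : Type) [Field k] (m : ℕ) (g h : CGen m) :
    deletionMatrix k m g * deletionMatrix k m h =
      !![cgen k m g * cgen k m h, cgen k m g * pqrIndicator k m h; 0, 0] := by
  simp only [deletionMatrix, Matrix.mul_fin_two, mul_zero, zero_mul, add_zero]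

lemma deletionMatrix_rel (k : Type) [Field k] (m : ℕ) {a b : FreeAlgebra k (CGen m)}
    (hab : CRel k m a b) :
    FreeAlgebra.lift k (deletionMatrix k m) a = FreeAlgebra.lift k (deletionMatrix k m) b := by
  have hrel := RingQuot.mkAlgHom_rel k hab
  cases hab <;>
    simp only [map_sub, map_add, map_mul, map_zero, lift_ι_apply, deletionMatrix_mul,
      ← cgen.eq_1] at hrel ⊢ <;>
    ext i j <;> fin_cases i <;> fin_cases j <;> simp [pqrIndicator, hrel]

/-- A representation of `C` by upper triangular matrices whose upper right entry is the linear map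
deleting the last letter of a word ending in `p`, `q` or `r` and killing all other words. -/
def deletionHom (k : Type) [Field k] (m : ℕ) :
    Calg k m →ₐ[k] Matrix (Fin 2) (Fin 2) (Calg k m) :=
  RingQuot.liftAlgHom k ⟨FreeAlgebra.lift k (deletionMatrix k m),
    fun _ _ hab => deletionMatrix_rel k m hab⟩

lemma deletionHom_cgen (k : Type) [Field k] (m : ℕ) (g : CGen m) :
    deletionHom k m (cgen k m g) = deletionMatrix k m g := by
  simp [deletionHom, cgen]

lemma deletionHom_apply_zero_zero (k : Type) [Field k] (m : ℕ) (e : Calg k m) :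
    deletionHom k m e 0 0 = e := by
  suffices h : deletionHom k m e 0 0 = e ∧ deletionHom k m e 1 0 = 0 from h.1
  obtain ⟨a, rfl⟩ := RingQuot.mkAlgHom_surjective k (CRel k m) e
  induction a using FreeAlgebra.induction with
  | grade0 c => simp [Matrix.algebraMap_matrix_apply]
  | grade1 g =>
    rw [← cgen.eq_1, deletionHom_cgen]
    simp [deletionMatrix]
  | mul a b ha hb => simp [Matrix.mul_apply, Fin.sum_univ_two, ha, hb]
  | add a b ha hb => simp [ha, hb]

/-- A generator among `p`, `q`, `r` is right cancellable in `C`. -/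
lemma mul_cgen_injective (k : Type) [Field k] (m : ℕ) {g : CGen m}
    (hg : pqrIndicator k m g = 1) : Function.Injective (· * cgen k m g) := by
  intro a b hab
  have h := congrArg (fun c => deletionHom k m c 0 1) hab
  simpa [deletionHom_cgen, deletionMatrix, Matrix.mul_apply, Fin.sum_univ_two, hg,
    deletionHom_apply_zero_zero] using h

/-- In the algebra `C`, the left annihilator of the matrix `α` is
zero: the left `C`-module map `C³ → C⁶` given by right multiplication by the
matrix `α'` with rows `(p,0,0,−p,p,0)`, `(0,q,0,0,−q,q)`, `(0,0,r,−r,0,r)`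
is injective. -/
theorem stmt2 (k : Type) [Field k] (m : ℕ) (hm : 5 ≤ m) :
    Function.Injective (fun e : Fin 3 → Calg k m =>
      (![e 0 * cp k m, e 1 * cq k m, e 2 * cr k m,
         -(e 0 * cp k m) - e 2 * cr k m,
         e 0 * cp k m - e 1 * cq k m,
         e 1 * cq k m + e 2 * cr k m] : Fin 6 → Calg k m)) := by
  intro e f hef
  have h0 := congrFun hef 0
  have h1 := congrFun hef 1
  have h2 := congrFun hef 2
  funext i
  fin_cases i
  · exact mul_cgen_injective k m (g := .p) rfl h0
  · exact mul_cgen_injective k m (g := .q) rfl h1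
  · exact mul_cgen_injective k m (g := .r) rfl h2
end
end

section
/- In the algebra C, the left annihilator of x₂ is the left ideal generated by v, w and x₁: {c ∈ C : c·x₂ = 0} = Cv + Cw + Cx₁. -/
noncomputable section

open FreeAlgebra

section Extension

variable {k X : Type} [Field k] {r : FreeAlgebra k X → FreeAlgebra k X → Prop}
  {N : Type} [AddCommGroup N] [Module k N] [Module (RingQuot r) N]
  [IsScalarTower k (RingQuot r) N]

/-- For a left module `N` over a presented algebra and a family `e` in `N` indexed by the
generators, the representation of the free algebra on `N × k` in which a generator `g` sends
`(a, c)` to `(g • a + c • e g, 0)`. -/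
def extensionRep (r : FreeAlgebra k X → FreeAlgebra k X → Prop)
    [Module (RingQuot r) N] [IsScalarTower k (RingQuot r) N] (e : X → N) :
    FreeAlgebra k X →ₐ[k] Module.End k (N × k) :=
  FreeAlgebra.lift k fun g =>
    (((Algebra.lsmul k k N (RingQuot.mkAlgHom k r (ι k g))).comp (LinearMap.fst k N k)) +
      (LinearMap.snd k N k).smulRight (e g)).prod 0

lemma extensionRep_ι (e : X → N) (g : X) (a : N × k) :
    extensionRep r e (ι k g) a = (RingQuot.mkAlgHom k r (ι k g) • a.1 + a.2 • e g, 0) := by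
  simp [extensionRep]

lemma extensionRep_apply_mk_zero (e : X → N) (f : FreeAlgebra k X) (a : N) :
    extensionRep r e f (a, 0) = (RingQuot.mkAlgHom k r f • a, 0) := by
  induction f using FreeAlgebra.induction generalizing a with
  | grade0 c => simp [Module.algebraMap_end_apply]
  | grade1 g => simp [extensionRep_ι]
  | mul f g hf hg => simp [hf, hg, mul_smul]
  | add f g hf hg => simp [hf, hg, add_smul]

lemma extensionRep_eq_of_rel (e : X → N) {a b : FreeAlgebra k X} (hab : r a b)
    (h : extensionRep r e a (0, 1) = extensionRep r e b (0, 1)) :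
    extensionRep r e a = extensionRep r e b := by
  refine LinearMap.ext fun p => ?_
  have hp : p = (p.1, 0) + p.2 • ((0, 1) : N × k) := by simp
  rw [hp, map_add, map_add, map_smul, map_smul, h, extensionRep_apply_mk_zero,
    extensionRep_apply_mk_zero, RingQuot.mkAlgHom_rel k hab]

lemma extensionRep_ι_mul_ι (e : X → N) (g h : X) :
    extensionRep r e (ι k g * ι k h) (0, 1) = (RingQuot.mkAlgHom k r (ι k g) • e h, 0) := by
  simp [extensionRep_ι]

/-- If the representation `extensionRep r e` respects the relations, then every left annihilator
of a generator annihilates the corresponding member of the family `e`. -/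
lemma smul_eq_zero_of_mul_generator_eq_zero (e : X → N)
    (he : ∀ ⦃a b⦄, r a b → extensionRep r e a (0, 1) = extensionRep r e b (0, 1)) (g : X) (c : RingQuot r)
    (hc : c * RingQuot.mkAlgHom k r (ι k g) = 0) : c • e g = 0 := by
  obtain ⟨f, rfl⟩ := RingQuot.mkAlgHom_surjective k r c
  have h := congrArg (RingQuot.liftAlgHom k ⟨extensionRep r e, fun _ _ h =>
    extensionRep_eq_of_rel e h (he h)⟩) hc
  rw [← map_mul, RingQuot.liftAlgHom_mkAlgHom_apply, map_zero, map_mul] at h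
  have h1 := congrArg Prod.fst (LinearMap.congr_fun h (0, 1))
  simpa [extensionRep_ι, extensionRep_apply_mk_zero] using h1

end Extension

section Relations

variable (k : Type) [Field k] (m : ℕ)

lemma cgen_mul_eq_zero {g h : CGen m} (H : CRel k m (ι k g * ι k h) 0) :
    cgen k m g * cgen k m h = 0 := by
  simpa [cgen] using RingQuot.mkAlgHom_rel k H

lemma cgen_mul_eq_cgen_mul {g h g' h' : CGen m}
    (H : CRel k m (ι k g * ι k h - ι k g' * ι k h') 0) :
    cgen k m g * cgen k m h = cgen k m g' * cgen k m h' := by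
  simpa [cgen, sub_eq_zero] using RingQuot.mkAlgHom_rel k H

variable {k m} {N : Type} [AddCommGroup N] [Module k N] [Module (Calg k m) N]
  [IsScalarTower k (Calg k m) N]

/-- The family equal to `a` at `x₂`, to `b` at `y₂`, and to `0` elsewhere. -/
def xyFamily (a b : N) : CGen m → N
  | .x i _ _ => if i = 2 then a else 0
  | .y i _ _ => if i = 2 then b else 0
  | _ => 0

/-- The family equal to `a` at `z₁` and to `0` elsewhere. -/
def zFamily (a : N) : CGen m → N
  | .z i _ _ => if i = 1 then a else 0
  | _ => 0

lemma smul_eq_zero_of_mul_cx_two_eq_zero (h4 : 1 ≤ m - 4) {a b : N}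
    (hv : cv k m • a = 0) (hw : cw k m • a = 0)
    (hx : cx k m 1 le_rfl (by omega) • a = 0)
    (hyz : cy k m 1 le_rfl (by omega) • a + cz k m 1 le_rfl (by omega) • b = 0)
    {c : Calg k m} (hc : c * cx k m 2 one_le_two (by omega) = 0) : c • a = 0 := by
  refine smul_eq_zero_of_mul_generator_eq_zero (xyFamily a b) (fun f f' hf => ?_)
    (.x 2 (by omega) (by omega)) c hc
  simp only [cv, cw, cx, cy, cz, cgen] at hv hw hx hyz
  cases hf <;>
    simp only [map_sub, map_add, map_zero, LinearMap.sub_apply, LinearMap.add_apply,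
      LinearMap.zero_apply, extensionRep_ι_mul_ι, xyFamily, Prod.mk_sub_mk, Prod.mk_add_mk,
      Prod.mk_eq_zero, smul_zero, sub_zero, add_zero, and_true, hv, hw, if_true,
      OfNat.one_ne_ofNat, if_false]
  case xx i h1 h2 =>
    split_ifs with h
    · obtain rfl : i = 1 := by omega
      exact hx
    · exact smul_zero _
  case yx_zy i h1 h2 =>
    split_ifs with h
    · subst h
      exact hyz
    · simp only [smul_zero, add_zero]

lemma smul_eq_zero_of_mul_cz_one_eq_zero (h4 : 1 ≤ m - 4) {a : N}
    (hs : cs k m • a = 0) (ht : ct k m • a = 0) (hu : cu k m • a = 0)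
    {c : Calg k m} (hc : c * cz k m 1 le_rfl h4 = 0) : c • a = 0 := by
  refine smul_eq_zero_of_mul_generator_eq_zero (zFamily a) (fun f f' hf => ?_)
    (.z 1 le_rfl h4) c hc
  simp only [cs, ct, cu, cgen] at hs ht hu
  cases hf <;>
    simp only [map_sub, map_add, map_zero, LinearMap.sub_apply, LinearMap.add_apply,
      LinearMap.zero_apply, extensionRep_ι_mul_ι, zFamily, Prod.mk_sub_mk, Prod.mk_add_mk,
      Prod.mk_eq_zero, smul_zero, sub_zero, add_zero, and_true, hs, ht, hu, if_true]
  case zz i h1 h2 =>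
    rw [if_neg (by omega), smul_zero]

variable (k m)

/-- The submodule of relations between `x₂` and `y₂`. -/
def xyRelations (h2 : 1 ≤ m - 2) (h3 : 1 ≤ m - 3) (h4 : 1 ≤ m - 4) :
    Submodule (Calg k m) (Calg k m × Calg k m) :=
  Submodule.span (Calg k m) {(cv k m, 0), (cw k m, 0), (cx k m 1 le_rfl h2, 0),
    (cy k m 1 le_rfl h3, cz k m 1 le_rfl h4)}

/-- If `c * x₂ = 0`, then `(c, 0)` is a combination of the relations between `x₂` and `y₂`. -/
lemma mem_xyRelations_of_mul_cx_two_eq_zero (h4 : 1 ≤ m - 4) (c : Calg k m)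
    (hc : c * cx k m 2 one_le_two (by omega) = 0) :
    (c, 0) ∈ xyRelations k m (by omega) (by omega) (by omega) := by
  set S := xyRelations k m (by omega) (by omega) (by omega) with hS
  have h : c • S.mkQ (1, 0) = 0 := by
    refine smul_eq_zero_of_mul_cx_two_eq_zero h4 (b := S.mkQ (0, 1)) ?_ ?_ ?_ ?_ hc <;>
    · simp only [← map_smul, ← map_add]
      rw [Submodule.mkQ_apply, Submodule.Quotient.mk_eq_zero]
      exact Submodule.subset_span (by simp)
  rw [← map_smul, Submodule.mkQ_apply, Submodule.Quotient.mk_eq_zero] at h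
  simpa using h

/-- The left annihilator of `z₁` is contained in the left ideal generated by `s`, `t`, `u`. -/
lemma mem_span_of_mul_cz_one_eq_zero (h4 : 1 ≤ m - 4) (c : Calg k m)
    (hc : c * cz k m 1 le_rfl h4 = 0) :
    c ∈ Submodule.span (Calg k m) {cs k m, ct k m, cu k m} := by
  set S := Submodule.span (Calg k m) {cs k m, ct k m, cu k m} with hS
  have h : c • S.mkQ 1 = 0 := by
    refine smul_eq_zero_of_mul_cz_one_eq_zero h4 ?_ ?_ ?_ hc <;>
    · rw [← map_smul, Submodule.mkQ_apply, Submodule.Quotient.mk_eq_zero]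
      exact Submodule.subset_span (by simp)
  rw [← map_smul, Submodule.mkQ_apply, Submodule.Quotient.mk_eq_zero] at h
  simpa using h

end Relations

/-- In the algebra `C`, the left annihilator of `x₂` is the left
ideal generated by `v`, `w` and `x₁`: `{c ∈ C : c·x₂ = 0} = Cv + Cw + Cx₁`. -/
theorem stmt3 (k : Type) [Field k] (m : ℕ) (hm : 5 ≤ m) :
    {c : Calg k m | c * cx k m 2 (by omega) (by omega) = 0}
      = (Submodule.span (Calg k m)
          {cv k m, cw k m, cx k m 1 (by omega) (by omega)} : Set (Calg k m)) := by
  have hvx : cv k m * cx k m 2 (by omega) (by omega) = 0 :=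
    cgen_mul_eq_zero k m (.vx2 (by omega))
  have hwx : cw k m * cx k m 2 (by omega) (by omega) = 0 :=
    cgen_mul_eq_zero k m (.wx2 (by omega))
  have hxx : cx k m 1 (by omega) (by omega) * cx k m 2 (by omega) (by omega) = 0 :=
    cgen_mul_eq_zero k m (.xx 1 le_rfl (by omega))
  have hsy : cs k m * cy k m 1 (by omega) (by omega) = cs k m * cv k m :=
    (cgen_mul_eq_cgen_mul k m (.sv_sy (by omega))).symm
  have hty : ct k m * cy k m 1 (by omega) (by omega) = ct k m * cw k m :=
    (cgen_mul_eq_cgen_mul k m (.tw_ty (by omega))).symm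
  have huy : cu k m * cy k m 1 (by omega) (by omega) = cu k m * cx k m 1 (by omega) (by omega) :=
    (cgen_mul_eq_cgen_mul k m (.ux_uy (by omega) (by omega))).symm
  ext c
  simp only [Set.mem_ofPred_eq, SetLike.mem_coe]
  constructor
  · intro hc
    have h := mem_xyRelations_of_mul_cx_two_eq_zero k m (by omega) c hc
    simp only [xyRelations, Submodule.mem_span_insert, Submodule.mem_span_singleton] at h
    obtain ⟨a₁, _, ⟨a₂, _, ⟨a₃, _, ⟨a₄, rfl⟩, rfl⟩, rfl⟩, h⟩ := h
    simp only [Prod.smul_mk, Prod.mk_add_mk, Prod.mk.injEq, smul_eq_mul, mul_zero, zero_add] at h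
    obtain ⟨rfl, h⟩ := h
    have h' := mem_span_of_mul_cz_one_eq_zero k m (by omega) a₄ h.symm
    simp only [Submodule.mem_span_insert, Submodule.mem_span_singleton, smul_eq_mul] at h'
    obtain ⟨b₁, _, ⟨b₂, _, ⟨b₃, rfl⟩, rfl⟩, rfl⟩ := h'
    simp only [Submodule.mem_span_insert, Submodule.mem_span_singleton, smul_eq_mul]
    refine ⟨a₁ + b₁ * cs k m, _, ⟨a₂ + b₂ * ct k m, _, ⟨a₃ + b₃ * cu k m, rfl⟩, rfl⟩, ?_⟩
    simp only [add_mul, mul_assoc, hsy, hty, huy]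
    abel
  · intro hc
    simp only [Submodule.mem_span_insert, Submodule.mem_span_singleton, smul_eq_mul] at hc
    obtain ⟨a₁, _, ⟨a₂, _, ⟨a₃, rfl⟩, rfl⟩, rfl⟩ := hc
    simp [add_mul, mul_assoc, hvx, hwx, hxx]
end
end

section
/- In the algebra C, the left annihilator of the matrix β is generated by the rows of α: the set {(e₁,…,e₆) ∈ C⁶ : e₁s + e₃u + e₄s = 0, −e₁s + e₂t + e₅t = 0, −e₂t − e₃u + e₆u = 0, −e₄s − e₅t − e₆u = 0} equals the left C-submodule of C⁶ generated by the three vectors (p,0,0,−p,p,0), (0,q,0,0,−q,q), (0,0,r,−r,0,r). -/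
noncomputable section

open FreeAlgebra

/-- A family of vectors in a left `C`-module that satisfies the defining relations of `C` in the
last letter, and vanishes on `v, w, x_i, y_i, z_i`, comes from a map on `C` that strips the last
letter of each word. -/
theorem exists_lastLetterMap {k : Type} [Field k] {m : ℕ} {N : Type*} [AddCommGroup N]
    [Module k N] [Module (Calg k m) N] [IsScalarTower k (Calg k m) N] (e : CGen m → N)
    (hpq : cn k m • e .p = cn k m • e .q) (hpr : cn k m • e .p = cn k m • e .r)
    (hst : cp k m • e .s = cp k m • e .t) (htu : cq k m • e .t = cq k m • e .u)
    (hsu : cr k m • e .s = cr k m • e .u) (hv : e .v = 0) (hw : e .w = 0)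
    (hx : ∀ i h1 h2, e (.x i h1 h2) = 0) (hy : ∀ i h1 h2, e (.y i h1 h2) = 0)
    (hz : ∀ i h1 h2, e (.z i h1 h2) = 0) :
    ∃ D : Calg k m →+ N, ∀ a g, D (a * cgen k m g) = a • e g := by
  let A : CGen m → Module.End k (N × k) := fun g =>
    (LinearMap.inl k N k) ∘ₗ (LinearMap.coprod (Algebra.lsmul k k N (cgen k m g))
      (LinearMap.toSpanSingleton k N (e g)))
  have hA : ∀ g n c, A g (n, c) = (cgen k m g • n + c • e g, 0) := fun g n c => rfl
  let F : FreeAlgebra k (CGen m) →ₐ[k] Module.End k (N × k) := FreeAlgebra.lift k A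
  have hF : ∀ g, F (ι k g) = A g := fun g => FreeAlgebra.lift_ι_apply A g
  let π := RingQuot.mkAlgHom k (CRel k m)
  have hFn : ∀ f n, F f (n, 0) = (π f • n, 0) := by
    intro f
    induction f using FreeAlgebra.induction with
    | grade0 c =>
      intro n
      rw [AlgHom.commutes, AlgHom.commutes, algebraMap_smul]
      simp [Module.algebraMap_end_apply]
    | grade1 g =>
      intro n
      rw [hF, hA]
      simp [π, cgen]
    | mul a b ha hb =>
      intro n
      rw [map_mul, map_mul, Module.End.mul_apply, hb, ha, mul_smul]
    | add a b ha hb =>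
      intro n
      rw [map_add, map_add, LinearMap.add_apply, hb, ha, add_smul]
      simp
  have hF1 : ∀ f g, F (f * ι k g) (0, 1) = (π f • e g, 0) := by
    intro f g
    rw [map_mul, Module.End.mul_apply, hF, hA, ← hFn]
    simp
  have hrel : ∀ ⦃a b⦄, CRel k m a b → F a = F b := by
    intro a b hab
    have h0 : b = 0 := by cases hab <;> rfl
    have hπ : π a = 0 := by
      rw [← map_zero π, ← h0]
      exact RingQuot.mkAlgHom_rel k hab
    have h1 : F a (0, 1) = 0 := by
      cases hab <;> simp only [map_sub, map_add, LinearMap.sub_apply, LinearMap.add_apply, hF1,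
        hv, hw, hx, hy, hz, smul_zero, Prod.mk_zero_zero, sub_zero, add_zero]
      all_goals
        rw [sub_eq_zero, Prod.mk.injEq]
        exact ⟨by assumption, rfl⟩
    rw [h0, map_zero]
    ext n
    · have h := hFn a n
      simp_all
    · have h := hFn a n
      simp_all
    · simp_all
    · simp_all
  let G : Calg k m →ₐ[k] Module.End k (N × k) := RingQuot.liftAlgHom k ⟨F, hrel⟩
  have hG : ∀ f, G (π f) = F f := fun f => RingQuot.liftAlgHom_mkAlgHom_apply k F hrel f
  refine ⟨{ toFun := fun a => (G a (0, 1)).1, map_zero' := by simp, map_add' := by simp }, ?_⟩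
  intro a g
  obtain ⟨f, rfl⟩ := RingQuot.mkAlgHom_surjective k (CRel k m) a
  change (G (π f * π (ι k g)) (0, 1)).1 = π f • e g
  rw [← map_mul, hG, hF1]

/-- The negation of `Calg k m` as a quotient only unfolds to its negation as a ring, so `neg_mul`
does not rewrite with it. -/
theorem calg_neg_mul {k : Type} [Field k] {m : ℕ} (a b : Calg k m) : -a * b = -(a * b) :=
  neg_mul a b

theorem calg_mul_neg {k : Type} [Field k] {m : ℕ} (a b : Calg k m) : a * -b = -(a * b) :=
  mul_neg a b

theorem eq_zero_of_mul_cn {k : Type} [Field k] {m : ℕ} {a : Calg k m}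
    (h : a * cn k m = 0) : a = 0 := by
  obtain ⟨D, hD⟩ := exists_lastLetterMap (k := k) (m := m) (N := Calg k m)
    (fun g => match g with | .n => 1 | _ => 0)
    (by simp) (by simp) (by simp) (by simp) (by simp) rfl rfl (by simp) (by simp) (by simp)
  have := hD a .n
  rw [← cn, h, map_zero] at this
  simpa using this.symm

theorem exists_of_mul_pqr {k : Type} [Field k] {m : ℕ} {a b c : Calg k m}
    (h : a * cp k m + b * cq k m + c * cr k m = 0) :
    ∃ x y : Calg k m, a = (x + y) * cn k m ∧ b = -(x * cn k m) ∧ c = -(y * cn k m) := by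
  let S : Submodule (Calg k m) (Calg k m × Calg k m × Calg k m) :=
    Submodule.span _ {(cn k m, -cn k m, 0), (cn k m, 0, -cn k m)}
  obtain ⟨D, hD⟩ := exists_lastLetterMap (k := k) (m := m) (N := _ ⧸ S)
    (fun g => match g with
      | .p => S.mkQ (1, 0, 0) | .q => S.mkQ (0, 1, 0) | .r => S.mkQ (0, 0, 1) | _ => 0)
    (by
      rw [← sub_eq_zero, ← map_smul, ← map_smul, ← map_sub, Submodule.mkQ_apply,
        Submodule.Quotient.mk_eq_zero]
      exact Submodule.subset_span (by simp))
    (by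
      rw [← sub_eq_zero, ← map_smul, ← map_smul, ← map_sub, Submodule.mkQ_apply,
        Submodule.Quotient.mk_eq_zero]
      exact Submodule.subset_span (by simp))
    (by simp) (by simp) (by simp) rfl rfl (by simp) (by simp) (by simp)
  have h' := congrArg D h
  rw [cp, cq, cr, map_add, map_add, hD, hD, hD, map_zero] at h'
  dsimp only at h'
  rw [← map_smul, ← map_smul, ← map_smul, ← map_add, ← map_add, Submodule.mkQ_apply,
    Submodule.Quotient.mk_eq_zero] at h'
  obtain ⟨x, y, hxy⟩ := Submodule.mem_span_pair.1 h'
  simp only [Prod.smul_mk, Prod.mk_add_mk, Prod.mk.injEq, smul_eq_mul, mul_one, mul_zero,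
    add_zero, zero_add, calg_mul_neg] at hxy
  exact ⟨x, y, by rw [add_mul, hxy.1], hxy.2.1.symm, hxy.2.2.symm⟩

theorem exists_of_mul_stu {k : Type} [Field k] {m : ℕ} {a b c : Calg k m}
    (h : a * cs k m + b * ct k m + c * cu k m = 0) :
    ∃ x y z : Calg k m, a = x * cp k m + z * cr k m ∧ b = -(x * cp k m) + y * cq k m ∧
      c = -(y * cq k m) - z * cr k m := by
  let S : Submodule (Calg k m) (Calg k m × Calg k m × Calg k m) :=
    Submodule.span _ {(cp k m, -cp k m, 0), (0, cq k m, -cq k m), (cr k m, 0, -cr k m)}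
  obtain ⟨D, hD⟩ := exists_lastLetterMap (k := k) (m := m) (N := _ ⧸ S)
    (fun g => match g with
      | .s => S.mkQ (1, 0, 0) | .t => S.mkQ (0, 1, 0) | .u => S.mkQ (0, 0, 1) | _ => 0)
    (by simp) (by simp)
    (by
      rw [← sub_eq_zero, ← map_smul, ← map_smul, ← map_sub, Submodule.mkQ_apply,
        Submodule.Quotient.mk_eq_zero]
      exact Submodule.subset_span (by simp))
    (by
      rw [← sub_eq_zero, ← map_smul, ← map_smul, ← map_sub, Submodule.mkQ_apply,
        Submodule.Quotient.mk_eq_zero]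
      exact Submodule.subset_span (by simp))
    (by
      rw [← sub_eq_zero, ← map_smul, ← map_smul, ← map_sub, Submodule.mkQ_apply,
        Submodule.Quotient.mk_eq_zero]
      exact Submodule.subset_span (by simp))
    rfl rfl (by simp) (by simp) (by simp)
  have h' := congrArg D h
  rw [cs, ct, cu, map_add, map_add, hD, hD, hD, map_zero] at h'
  dsimp only at h'
  rw [← map_smul, ← map_smul, ← map_smul, ← map_add, ← map_add, Submodule.mkQ_apply,
    Submodule.Quotient.mk_eq_zero] at h'
  obtain ⟨x, y, z, hxyz⟩ := Submodule.mem_span_triple.1 h'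
  simp only [Prod.smul_mk, Prod.mk_add_mk, Prod.mk.injEq, smul_eq_mul, mul_one, mul_zero,
    add_zero, zero_add, calg_mul_neg] at hxyz
  refine ⟨x, y, z, hxyz.1.symm, hxyz.2.1.symm, ?_⟩
  rw [← hxyz.2.2]
  abel

theorem cgen_mul_eq {k : Type} [Field k] {m : ℕ} {g h h' : CGen m}
    (H : CRel k m (ι k g * ι k h - ι k g * ι k h') 0) :
    cgen k m g * cgen k m h = cgen k m g * cgen k m h' := by
  have := RingQuot.mkAlgHom_rel k H
  rw [map_sub, map_mul, map_mul, map_zero, sub_eq_zero] at this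
  exact this

theorem cn_mul_cp_eq_cq (k : Type) [Field k] (m : ℕ) : cn k m * cp k m = cn k m * cq k m :=
  cgen_mul_eq .np_nq

theorem cn_mul_cp_eq_cr (k : Type) [Field k] (m : ℕ) : cn k m * cp k m = cn k m * cr k m :=
  cgen_mul_eq .np_nr

theorem cp_mul_cs (k : Type) [Field k] (m : ℕ) : cp k m * cs k m = cp k m * ct k m :=
  cgen_mul_eq .ps_pt

theorem cq_mul_ct (k : Type) [Field k] (m : ℕ) : cq k m * ct k m = cq k m * cu k m :=
  cgen_mul_eq .qt_qu

theorem cr_mul_cs (k : Type) [Field k] (m : ℕ) : cr k m * cs k m = cr k m * cu k m :=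
  cgen_mul_eq .rs_ru

theorem exists_of_mul_st {k : Type} [Field k] {m : ℕ} {a b : Calg k m}
    (h : a * cs k m + b * ct k m = 0) :
    ∃ x : Calg k m, a = x * cp k m ∧ b = -(x * cp k m) := by
  obtain ⟨x, y, z, ha, hb, hc⟩ := exists_of_mul_stu (a := a) (b := b) (c := 0) (by simpa using h)
  obtain ⟨d, f, h1, h2, h3⟩ := exists_of_mul_pqr (a := 0) (b := y) (c := z)
    (by rw [zero_mul, zero_add, ← neg_eq_zero, neg_add', ← hc])
  have hf : f = -d := (neg_eq_of_add_eq_zero_right (eq_zero_of_mul_cn h1.symm)).symm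
  subst hf h2 h3
  refine ⟨x + d * cn k m, ?_, ?_⟩
  · rw [ha, add_mul, mul_assoc d, cn_mul_cp_eq_cr]
    simp only [calg_neg_mul, neg_neg, mul_assoc]
  · rw [hb, add_mul, mul_assoc d, cn_mul_cp_eq_cq]
    simp only [calg_neg_mul, mul_assoc]
    abel

theorem exists_of_mul_tu {k : Type} [Field k] {m : ℕ} {b c : Calg k m}
    (h : b * ct k m + c * cu k m = 0) :
    ∃ y : Calg k m, b = y * cq k m ∧ c = -(y * cq k m) := by
  obtain ⟨x, y, z, ha, hb, hc⟩ := exists_of_mul_stu (a := 0) (b := b) (c := c) (by simpa using h)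
  obtain ⟨d, f, h1, h2, h3⟩ := exists_of_mul_pqr (a := x) (b := 0) (c := z)
    (by rw [zero_mul, add_zero, ← ha])
  have hd : d = 0 := eq_zero_of_mul_cn (neg_eq_zero.1 h2.symm)
  subst hd h1 h3
  refine ⟨y - f * cn k m, ?_, ?_⟩
  · rw [hb, sub_mul, mul_assoc f, ← cn_mul_cp_eq_cq, zero_add, mul_assoc]
    abel
  · rw [hc, sub_mul, mul_assoc f, ← cn_mul_cp_eq_cq, cn_mul_cp_eq_cr, calg_neg_mul, mul_assoc]
    abel

theorem exists_of_mul_su {k : Type} [Field k] {m : ℕ} {a c : Calg k m}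
    (h : a * cs k m + c * cu k m = 0) :
    ∃ z : Calg k m, a = -(z * cr k m) ∧ c = z * cr k m := by
  obtain ⟨x, y, z, ha, hb, hc⟩ := exists_of_mul_stu (a := a) (b := 0) (c := c) (by simpa using h)
  obtain ⟨d, f, h1, h2, h3⟩ := exists_of_mul_pqr (a := -x) (b := y) (c := 0)
    (by rw [zero_mul, add_zero, calg_neg_mul, ← hb])
  have hf : f = 0 := eq_zero_of_mul_cn (neg_eq_zero.1 h3.symm)
  subst hf h2
  rw [add_zero, neg_eq_iff_eq_neg] at h1
  subst h1
  refine ⟨d * cn k m - z, ?_, ?_⟩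
  · rw [ha, sub_mul, mul_assoc d, ← cn_mul_cp_eq_cr, calg_neg_mul, mul_assoc]
    abel
  · rw [hc, sub_mul, mul_assoc d, ← cn_mul_cp_eq_cr, cn_mul_cp_eq_cq, calg_neg_mul, mul_assoc]
    abel

/-- In the algebra `C`, the left annihilator of the matrix `β` is
generated by the rows of `α`. -/
theorem stmt4 (k : Type) [Field k] (m : ℕ) (hm : 5 ≤ m) :
    {e : Fin 6 → Calg k m |
        e 0 * cs k m + e 2 * cu k m + e 3 * cs k m = 0 ∧
        -(e 0 * cs k m) + e 1 * ct k m + e 4 * ct k m = 0 ∧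
        -(e 1 * ct k m) - e 2 * cu k m + e 5 * cu k m = 0 ∧
        -(e 3 * cs k m) - e 4 * ct k m - e 5 * cu k m = 0}
      = (Submodule.span (Calg k m)
          {![cp k m, 0, 0, -cp k m, cp k m, 0],
           ![0, cq k m, 0, 0, -cq k m, cq k m],
           ![0, 0, cr k m, -cr k m, 0, cr k m]} : Set (Fin 6 → Calg k m)) := by
  ext e
  simp only [Set.mem_ofPred_eq, SetLike.mem_coe, Submodule.mem_span_triple]
  constructor
  · rintro ⟨h1, h2, h3, -⟩
    obtain ⟨c, hc, hc'⟩ := exists_of_mul_su (a := e 0 + e 3) (c := e 2)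
      (by rw [← h1, add_mul]; abel)
    obtain ⟨a, ha, ha'⟩ := exists_of_mul_st (a := e 0) (b := -(e 1 + e 4))
      (by rw [← neg_eq_zero, ← h2, calg_neg_mul, add_mul]; abel)
    obtain ⟨b, hb, hb'⟩ := exists_of_mul_tu (b := e 1) (c := e 2 - e 5)
      (by rw [← neg_eq_zero, ← h3, sub_mul]; abel)
    have h_3 : e 3 = -(c * cr k m) - e 0 := eq_sub_of_add_eq' hc
    have h_4 : e 4 = a * cp k m - e 1 := eq_sub_of_add_eq' (neg_injective ha')
    have h_5 : e 5 = e 2 + b * cq k m := by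
      rw [← neg_eq_iff_eq_neg.2 hb']
      abel
    refine ⟨a, b, c, ?_⟩
    ext i
    fin_cases i <;> simp [calg_mul_neg, h_3, h_4, h_5, ha, hb, hc'] <;> abel
  · rintro ⟨a, b, c, rfl⟩
    simp only [Pi.add_apply, Pi.smul_apply, smul_eq_mul, Matrix.cons_val, mul_zero, add_zero,
      zero_add, calg_mul_neg, calg_neg_mul, add_mul, mul_assoc, cp_mul_cs, ← cq_mul_ct, ← cr_mul_cs]
    refine ⟨?_, ?_, ?_, ?_⟩ <;> abel
end
end

section
/- In the algebra C, the left annihilator of the matrix δ is generated by η: the set {(e₁,e₂,e₃) ∈ C³ : −e₁p − e₃r = 0, e₁p − e₂q = 0, e₂q + e₃r = 0} equals the cyclic left C-submodule of C³ generated by the vector (n, n, −n). -/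
noncomputable section

open FreeAlgebra

section Derivation

variable {k : Type} [Field k] {m : ℕ} {M : Type} [AddCommGroup M] [Module k M]
  [Module (Calg k m) M] [IsScalarTower k (Calg k m) M]

/-- The family on generators taking the given values at `p, q, r` and vanishing elsewhere. -/
def pqrValue (dp dq dr : M) : CGen m → M
  | CGen.p => dp
  | CGen.q => dq
  | CGen.r => dr
  | _ => 0

/-- The action of a generator `g` on `M × k`, sending `(a, c)` to `(g • a + c • d g, 0)`. -/
def genAction (d : CGen m → M) (g : CGen m) : Module.End k (M × k) :=
  (LinearMap.inl k M k).comp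
    ((Algebra.lsmul k k M (cgen k m g)).comp (LinearMap.fst k M k) +
      (LinearMap.toSpanSingleton k M (d g)).comp (LinearMap.snd k M k))

theorem genAction_apply (d : CGen m → M) (g : CGen m) (a : M × k) :
    genAction d g a = (cgen k m g • a.1 + a.2 • d g, 0) := by
  simp [genAction]

/-- The action of the free algebra on `M × k` extends the given action on `M`. -/
theorem lift_genAction_inl (d : CGen m → M) (f : FreeAlgebra k (CGen m)) (a : M) :
    FreeAlgebra.lift k (genAction (k := k) d) f (a, 0) =
      (RingQuot.mkAlgHom k (CRel k m) f • a, 0) := by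
  induction f using FreeAlgebra.induction generalizing a with
  | grade0 c => simp [Module.algebraMap_end_apply]
  | grade1 g => simp [genAction_apply, cgen]
  | mul f g hf hg => simp [hf, hg, mul_smul]
  | add f g hf hg => simp [hf, hg, add_smul]

theorem lift_genAction_rel (dp dq dr : M) (hq : cn k m • dp = cn k m • dq)
    (hr : cn k m • dp = cn k m • dr) ⦃x y : FreeAlgebra k (CGen m)⦄ (h : CRel k m x y) :
    FreeAlgebra.lift k (genAction (k := k) (pqrValue dp dq dr)) x =
      FreeAlgebra.lift k (genAction (k := k) (pqrValue dp dq dr)) y := by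
  have hM := RingQuot.mkAlgHom_rel k h
  apply LinearMap.prod_ext
  · refine LinearMap.ext fun a => ?_
    simp [lift_genAction_inl, hM]
  · refine LinearMap.ext_ring ?_
    rw [cn] at hq hr
    cases h <;> simp [genAction_apply, pqrValue, ← hq, ← hr]

/-- Values `dp, dq, dr` in a left `C`-module with `n dp = n dq = n dr` extend to a linear map `D` on
`C` with `D (a p) = a dp`, `D (a q) = a dq`, `D (a r) = a dr`. -/
theorem exists_linearMap_mul_pqr (dp dq dr : M) (hq : cn k m • dp = cn k m • dq)
    (hr : cn k m • dp = cn k m • dr) :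
    ∃ D : Calg k m →ₗ[k] M, ∀ a, D (a * cp k m) = a • dp ∧ D (a * cq k m) = a • dq ∧
      D (a * cr k m) = a • dr := by
  let A : Calg k m →ₐ[k] Module.End k (M × k) := RingQuot.liftAlgHom k
    ⟨FreeAlgebra.lift k (genAction (pqrValue dp dq dr)), lift_genAction_rel dp dq dr hq hr⟩
  have hA : ∀ f, A (RingQuot.mkAlgHom k (CRel k m) f) =
      FreeAlgebra.lift k (genAction (pqrValue dp dq dr)) f := fun f =>
    RingQuot.liftAlgHom_mkAlgHom_apply _ _ _ _
  have key : ∀ a g, (A (a * cgen k m g) (0, 1)).1 = a • pqrValue dp dq dr g := by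
    intro a g
    obtain ⟨f, rfl⟩ := RingQuot.mkAlgHom_surjective k (CRel k m) a
    rw [cgen, ← map_mul, hA]
    simp [genAction_apply, lift_genAction_inl]
  exact ⟨(LinearMap.fst k M k).comp ((LinearMap.applyₗ (0, 1)).comp A.toLinearMap),
    fun a => ⟨key a _, key a _, key a _⟩⟩

end Derivation

theorem cgen_rel {k : Type} [Field k] {m : ℕ} {a b c d : CGen m}
    (h : CRel k m (ι k a * ι k b - ι k c * ι k d) 0) :
    cgen k m a * cgen k m b = cgen k m c * cgen k m d := by
  have := RingQuot.mkAlgHom_rel k h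
  simpa [cgen, sub_eq_zero] using this

/-- In the algebra `C`, the left annihilator of the matrix `δ` is
generated by `η = (n, n, −n)`. -/
theorem stmt5 (k : Type) [Field k] (m : ℕ) (hm : 5 ≤ m) :
    {e : Fin 3 → Calg k m |
        -(e 0 * cp k m) - e 2 * cr k m = 0 ∧
        e 0 * cp k m - e 1 * cq k m = 0 ∧
        e 1 * cq k m + e 2 * cr k m = 0}
      = (Submodule.span (Calg k m)
          {![cn k m, cn k m, -cn k m]} : Set (Fin 3 → Calg k m)) := by
  have hnq : cn k m * cp k m = cn k m * cq k m := cgen_rel CRel.np_nq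
  have hnr : cn k m * cp k m = cn k m * cr k m := cgen_rel CRel.np_nr
  have hneg (a b : Calg k m) : -a * b = -(a * b) := neg_mul a b
  have hneg' (a b : Calg k m) : a * -b = -(a * b) := mul_neg a b
  ext e
  simp only [Set.mem_ofPred_eq, SetLike.mem_coe, Submodule.mem_span_singleton]
  constructor
  · rintro ⟨h1, h2, -⟩
    obtain ⟨D, hD⟩ := exists_linearMap_mul_pqr (k := k) (m := m) (1 : Calg k m) 1 1 rfl rfl
    have h01 : e 0 = e 1 := by
      simpa [hD, sub_eq_zero] using congrArg D h2
    have h02 : -e 0 - e 2 = 0 := by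
      simpa [hD] using congrArg D h1
    let N := Submodule.span (Calg k m) {cn k m}
    have hn : cn k m • (Submodule.Quotient.mk 1 : Calg k m ⧸ N) = 0 := by
      rw [← Submodule.Quotient.mk_smul, Submodule.Quotient.mk_eq_zero, smul_eq_mul, mul_one]
      exact Submodule.mem_span_singleton_self (R := Calg k m) (cn k m)
    obtain ⟨E, hE⟩ := exists_linearMap_mul_pqr (k := k) (m := m)
      (Submodule.Quotient.mk 1 : Calg k m ⧸ N) 0 0 (by rw [hn, smul_zero]) (by rw [hn, smul_zero])
    have h0 : e 0 • (Submodule.Quotient.mk 1 : Calg k m ⧸ N) = 0 := by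
      simpa [hE] using congrArg E h2
    rw [← Submodule.Quotient.mk_smul, Submodule.Quotient.mk_eq_zero, smul_eq_mul, mul_one,
      Submodule.mem_span_singleton] at h0
    obtain ⟨c, hc⟩ := h0
    rw [smul_eq_mul] at hc
    refine ⟨c, funext fun i => ?_⟩
    fin_cases i
    · simpa using hc
    · simpa [← h01] using hc
    · simpa [hc, hneg'] using sub_eq_zero.mp h02
  · rintro ⟨c, rfl⟩
    simp [mul_assoc, hneg, hneg', ← hnq, ← hnr]
end
end

section
/- In the algebra C, the left annihilator of the column vector γ' = (v, w, x₁)ᵗ is generated by the rows of β': the set {(e₁,e₂,e₃) ∈ C³ : e₁v + e₂w + e₃x₁ = 0} equals the left C-submodule of C³ generated by the three vectors (s,−s,0), (0,t,−t), (u,0,−u). -/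
noncomputable section

open FreeAlgebra

section FoxDerivative

variable {k X N : Type*} [Field k] {r : FreeAlgebra k X → FreeAlgebra k X → Prop}
  [AddCommGroup N] [Module k N] [Module (RingQuot r) N] [IsScalarTower k (RingQuot r) N]

/-- The action of the free algebra on `N × k` in which a generator `g` sends `(n, a)` to
`(g • n + a • e g, 0)`. -/
def foxAction (r : FreeAlgebra k X → FreeAlgebra k X → Prop) [Module (RingQuot r) N]
    [IsScalarTower k (RingQuot r) N] (e : X → N) :
    FreeAlgebra k X →ₐ[k] Module.End k (N × k) :=
  FreeAlgebra.lift k fun g =>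
    LinearMap.inl k N k ∘ₗ
      (Algebra.lsmul k k N (RingQuot.mkAlgHom k r (ι k g))).coprod
        (LinearMap.toSpanSingleton k N (e g))

theorem foxAction_ι (e : X → N) (g : X) (n : N) (a : k) :
    foxAction r e (ι k g) (n, a) = (RingQuot.mkAlgHom k r (ι k g) • n + a • e g, 0) := by
  simp [foxAction]

theorem foxAction_inl (e : X → N) (f : FreeAlgebra k X) (n : N) :
    foxAction r e f (n, 0) = (RingQuot.mkAlgHom k r f • n, 0) := by
  induction f using FreeAlgebra.induction generalizing n with
  | grade0 a => simp [Module.algebraMap_end_apply]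
  | grade1 g => simp [foxAction_ι]
  | mul f g hf hg => simp [hf, hg, mul_smul]
  | add f g hf hg => simp [hf, hg, add_smul]

/-- A family `e` in a left module satisfying the relations, read as relations on the last letters,
extends to a linear map `δ` with `δ (c * g) = c • e g` for all generators `g`. -/
theorem exists_fox_derivative (e : X → N)
    (he : ∀ a b, r a b → foxAction r e a (0, 1) = foxAction r e b (0, 1)) :
    ∃ δ : RingQuot r →ₗ[k] N, ∀ c g, δ (c * RingQuot.mkAlgHom k r (ι k g)) = c • e g := by
  have hr : ∀ ⦃a b⦄, r a b → foxAction r e a = foxAction r e b := by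
    intro a b hab
    refine LinearMap.prod_ext (LinearMap.ext fun n => ?_) (LinearMap.ext_ring (he a b hab))
    simp [foxAction_inl, RingQuot.mkAlgHom_rel k hab]
  let Ψ := RingQuot.liftAlgHom k ⟨foxAction r e, hr⟩
  refine ⟨LinearMap.fst k N k ∘ₗ LinearMap.applyₗ (0, 1) ∘ₗ Ψ.toLinearMap, fun c g => ?_⟩
  obtain ⟨f, rfl⟩ := RingQuot.mkAlgHom_surjective k r c
  rw [← map_mul]
  simp [Ψ, foxAction_ι, foxAction_inl]

end FoxDerivative

section Presentations

variable (k : Type) [Field k] (m : ℕ)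

theorem Calg.mul_neg (a b : Calg k m) : a * -b = -(a * b) := _root_.mul_neg a b

theorem Calg.neg_mul (a b : Calg k m) : -a * b = -(a * b) := _root_.neg_mul a b

theorem cgen_mul_eq_of_rel {a b c d : CGen m}
    (h : CRel k m (ι k a * ι k b - ι k c * ι k d) 0) :
    cgen k m a * cgen k m b = cgen k m c * cgen k m d := by
  have := RingQuot.mkAlgHom_rel k h
  rw [map_sub, map_zero, map_mul, map_mul, sub_eq_zero] at this
  exact this

/-- The relations of `C` ending in `s`, `t` or `u`. -/
def stuRel : Fin 3 → Fin 3 → Calg k m :=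
  ![![cp k m, -cp k m, 0], ![0, cq k m, -cq k m], ![cr k m, 0, -cr k m]]

/-- The relations of `C` ending in `v`, `w`, `x₁` or `y₁`. -/
def vwxyRel : Fin 6 → Fin 4 → Calg k m :=
  ![![cs k m, -cs k m, 0, 0], ![0, ct k m, -ct k m, 0], ![cu k m, 0, -cu k m, 0],
    ![cs k m, 0, 0, -cs k m], ![0, ct k m, 0, -ct k m], ![0, 0, cu k m, -cu k m]]

/-- The basis vectors attached to the letters `s`, `t`, `u`. -/
def stuLetter : CGen m → Fin 3 → Calg k m
  | .s => Pi.single 0 1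
  | .t => Pi.single 1 1
  | .u => Pi.single 2 1
  | _ => 0

/-- The basis vectors attached to the letters `v`, `w`, `x₁`, `y₁`. -/
def vwxyLetter : CGen m → Fin 4 → Calg k m
  | .v => Pi.single 0 1
  | .w => Pi.single 1 1
  | .x i _ _ => if i = 1 then Pi.single 2 1 else 0
  | .y i _ _ => if i = 1 then Pi.single 3 1 else 0
  | _ => 0

theorem stu_annihilator {c : Fin 3 → Calg k m}
    (h : c 0 * cs k m + c 1 * ct k m + c 2 * cu k m = 0) :
    ∃ d : Fin 3 → Calg k m, ∑ i, d i • stuRel k m i = c := by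
  let S := Submodule.span (Calg k m) (Set.range (stuRel k m))
  have hS : ∀ {a b c d : CGen m} (i : Fin 3),
      stuRel k m i = cgen k m a • stuLetter k m b - cgen k m c • stuLetter k m d →
        cgen k m a • S.mkQ (stuLetter k m b) = cgen k m c • S.mkQ (stuLetter k m d) := by
    intro a b c d i hi
    rw [← sub_eq_zero, ← map_smul, ← map_smul, ← map_sub, ← hi, Submodule.mkQ_apply,
      Submodule.Quotient.mk_eq_zero]
    exact Submodule.subset_span ⟨i, rfl⟩
  obtain ⟨δ, hδ⟩ := exists_fox_derivative (k := k) (r := CRel k m)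
      (fun g => S.mkQ (stuLetter k m g)) (by
    intro a b hab
    cases hab <;>
      simp only [map_sub, map_add, map_mul, Module.End.mul_apply, LinearMap.sub_apply,
        LinearMap.add_apply, foxAction_ι, foxAction_inl, Prod.mk_sub_mk, Prod.mk_add_mk, map_zero,
        LinearMap.zero_apply, smul_zero, zero_add, one_smul, sub_self, add_zero,
        Prod.mk_eq_zero, and_true, sub_eq_zero]
    case ps_pt =>
      refine hS 0 (funext fun i => ?_)
      fin_cases i <;> simp [stuLetter, stuRel, cp, cq, cr]
    case qt_qu =>
      refine hS 1 (funext fun i => ?_)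
      fin_cases i <;> simp [stuLetter, stuRel, cp, cq, cr]
    case rs_ru =>
      refine hS 2 (funext fun i => ?_)
      fin_cases i <;> simp [stuLetter, stuRel, cp, cq, cr]
    all_goals simp [stuLetter])
  have h' := congrArg δ h
  have hδ' : ∀ c g, δ (c * cgen k m g) = c • S.mkQ (stuLetter k m g) := hδ
  simp only [cs, ct, cu, map_add, hδ', map_zero, ← map_smul] at h'
  rw [← map_add, ← map_add, Submodule.mkQ_apply, Submodule.Quotient.mk_eq_zero,
    Submodule.mem_span_range_iff_exists_fun] at h'
  obtain ⟨d, hd⟩ := h'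
  refine ⟨d, hd.trans (funext fun i => ?_)⟩
  fin_cases i <;> simp [stuLetter]

theorem vwxy_annihilator {c : Fin 4 → Calg k m} (hm : 1 ≤ m - 2)
    (h : c 0 * cv k m + c 1 * cw k m + c 2 * cx k m 1 le_rfl hm = 0) (hc : c 3 = 0) :
    ∃ d : Fin 6 → Calg k m, ∑ i, d i • vwxyRel k m i = c := by
  let S := Submodule.span (Calg k m) (Set.range (vwxyRel k m))
  have hS : ∀ {a b c d : CGen m} (i : Fin 6),
      vwxyRel k m i = cgen k m a • vwxyLetter k m b - cgen k m c • vwxyLetter k m d →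
        cgen k m a • S.mkQ (vwxyLetter k m b) = cgen k m c • S.mkQ (vwxyLetter k m d) := by
    intro a b c d i hi
    rw [← sub_eq_zero, ← map_smul, ← map_smul, ← map_sub, ← hi, Submodule.mkQ_apply,
      Submodule.Quotient.mk_eq_zero]
    exact Submodule.subset_span ⟨i, rfl⟩
  obtain ⟨δ, hδ⟩ := exists_fox_derivative (k := k) (r := CRel k m)
      (fun g => S.mkQ (vwxyLetter k m g)) (by
    intro a b hab
    cases hab <;>
      simp only [map_sub, map_add, map_mul, Module.End.mul_apply, LinearMap.sub_apply,
        LinearMap.add_apply, foxAction_ι, foxAction_inl, Prod.mk_sub_mk, Prod.mk_add_mk, map_zero,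
        LinearMap.zero_apply, smul_zero, zero_add, one_smul, sub_self, add_zero,
        Prod.mk_eq_zero, and_true, sub_eq_zero]
    case sv_sw =>
      refine hS 0 (funext fun i => ?_)
      fin_cases i <;> simp [vwxyLetter, vwxyRel, cs, ct, cu]
    case tw_tx =>
      refine hS 1 (funext fun i => ?_)
      fin_cases i <;> simp [vwxyLetter, vwxyRel, cs, ct, cu]
    case uv_ux =>
      refine hS 2 (funext fun i => ?_)
      fin_cases i <;> simp [vwxyLetter, vwxyRel, cs, ct, cu]
    case sv_sy =>
      refine hS 3 (funext fun i => ?_)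
      fin_cases i <;> simp [vwxyLetter, vwxyRel, cs, ct, cu]
    case tw_ty =>
      refine hS 4 (funext fun i => ?_)
      fin_cases i <;> simp [vwxyLetter, vwxyRel, cs, ct, cu]
    case ux_uy =>
      refine hS 5 (funext fun i => ?_)
      fin_cases i <;> simp [vwxyLetter, vwxyRel, cs, ct, cu]
    all_goals simp (disch := omega) [vwxyLetter, if_neg])
  have h' := congrArg δ h
  have hδ' : ∀ c g, δ (c * cgen k m g) = c • S.mkQ (vwxyLetter k m g) := hδ
  simp only [cv, cw, cx, map_add, hδ', map_zero, ← map_smul] at h'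
  rw [← map_add, ← map_add, Submodule.mkQ_apply, Submodule.Quotient.mk_eq_zero,
    Submodule.mem_span_range_iff_exists_fun] at h'
  obtain ⟨d, hd⟩ := h'
  refine ⟨d, hd.trans (funext fun i => ?_)⟩
  fin_cases i <;> simp [vwxyLetter, hc]

end Presentations

/-- In the algebra `C`, the left annihilator of the column vector
`γ' = (v, w, x₁)ᵗ` is generated by the rows of `β'`. -/
theorem stmt7 (k : Type) [Field k] (m : ℕ) (hm : 5 ≤ m) :
    {e : Fin 3 → Calg k m |
        e 0 * cv k m + e 1 * cw k m + e 2 * cx k m 1 (by omega) (by omega) = 0}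
      = (Submodule.span (Calg k m)
          {![cs k m, -cs k m, 0], ![0, ct k m, -ct k m], ![cu k m, 0, -cu k m]} :
            Set (Fin 3 → Calg k m)) := by
  ext e
  simp only [Set.mem_ofPred_eq, SetLike.mem_coe, Submodule.mem_span_insert,
    Submodule.mem_span_singleton]
  have hsv : cs k m * cv k m = cs k m * cw k m := cgen_mul_eq_of_rel k m .sv_sw
  have htw : ct k m * cw k m = ct k m * cx k m 1 le_rfl (by omega) :=
    cgen_mul_eq_of_rel k m (.tw_tx (by omega))
  have huv : cu k m * cv k m = cu k m * cx k m 1 le_rfl (by omega) :=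
    cgen_mul_eq_of_rel k m (.uv_ux (by omega))
  have hps : cp k m * cs k m = cp k m * ct k m := cgen_mul_eq_of_rel k m .ps_pt
  have hqt : cq k m * ct k m = cq k m * cu k m := cgen_mul_eq_of_rel k m .qt_qu
  have hrs : cr k m * cs k m = cr k m * cu k m := cgen_mul_eq_of_rel k m .rs_ru
  constructor
  · intro h
    obtain ⟨d, hd⟩ := vwxy_annihilator k m (c := ![e 0, e 1, e 2, 0]) (by omega) h rfl
    have h0 := congrFun hd 0
    have h1 := congrFun hd 1
    have h2 := congrFun hd 2
    have h3 := congrFun hd 3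
    simp only [Fin.sum_univ_succ] at h0 h1 h2 h3
    simp [vwxyRel] at h0 h1 h2 h3
    obtain ⟨b, hb⟩ := stu_annihilator k m (c := ![d 3, d 4, d 5]) (by
      simp
      rw [← neg_eq_zero, ← h3]
      simp only [Calg.mul_neg]
      abel)
    have h4 := congrFun hb 0
    have h5 := congrFun hb 1
    have h6 := congrFun hb 2
    simp [Fin.sum_univ_succ, stuRel] at h4 h5 h6
    refine ⟨d 0 + b 0 * cp k m, _, ⟨d 1 + b 1 * cq k m, _, ⟨d 2 + b 2 * cr k m, rfl⟩, rfl⟩, ?_⟩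
    funext i
    fin_cases i <;> simp [← h0, ← h1, ← h2, ← h4, ← h5, ← h6, add_mul, mul_assoc, Calg.mul_neg,
      Calg.neg_mul, hps, hqt, hrs]
      <;> abel
  · rintro ⟨a, _, ⟨b, _, ⟨c, rfl⟩, rfl⟩, rfl⟩
    simp [add_mul, mul_assoc, Calg.mul_neg,
      Calg.neg_mul, hsv, htw, huv]
    abel
end
end

section
/- In the algebra C, the rows of δ generate the left annihilator of the column vector ε = (s, t, u)ᵗ: the set {(d₁,d₂,d₃) ∈ C³ : d₁s + d₂t + d₃u = 0} equals the left C-submodule of C³ generated by the three vectors (−p,p,0), (0,−q,q), (−r,0,r). -/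
noncomputable section

open FreeAlgebra

/-- The generator `g` acting on `M × k` by `(a, c) ↦ (g • a + c • T g, 0)`. -/
def genAct (k : Type) [Field k] (m : ℕ) {M : Type} [AddCommGroup M] [Module k M]
    [Module (Calg k m) M] [IsScalarTower k (Calg k m) M] (T : CGen m → M) (g : CGen m) :
    Module.End k (M × k) :=
  LinearMap.prod
    ((Algebra.lsmul k k M (cgen k m g)).comp (LinearMap.fst k M k) +
      (LinearMap.snd k M k).smulRight (T g)) 0

section GenAct

variable {k : Type} [Field k] {m : ℕ} {M : Type} [AddCommGroup M] [Module k M]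
  [Module (Calg k m) M] [IsScalarTower k (Calg k m) M] (T : CGen m → M)

@[simp]
theorem genAct_apply (g : CGen m) (v : M × k) :
    genAct k m T g v = (cgen k m g • v.1 + v.2 • T g, 0) := by
  simp [genAct]

theorem lift_genAct_inl (a : FreeAlgebra k (CGen m)) (b : M) :
    FreeAlgebra.lift k (genAct k m T) a (b, 0) =
      (RingQuot.mkAlgHom k (CRel k m) a • b, 0) := by
  induction a using FreeAlgebra.induction generalizing b with
  | grade0 c => simp [Algebra.algebraMap_eq_smul_one]
  | grade1 g => simp [cgen]
  | mul a a' ha ha' => simp [ha, ha', mul_smul]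
  | add a a' ha ha' => simp [ha, ha', add_smul]

/-- Values on the generators prescribe a map `D : C → M` with `D (a * g) = a • T g`, provided they
respect the relations. -/
theorem exists_linearMap_mul_cgen
    (hT : ∀ a, CRel k m a 0 → FreeAlgebra.lift k (genAct k m T) a (0, 1) = 0) :
    ∃ D : Calg k m →ₗ[k] M, ∀ a g, D (a * cgen k m g) = a • T g := by
  have hrel : ∀ ⦃a b⦄, CRel k m a b →
      FreeAlgebra.lift k (genAct k m T) a = FreeAlgebra.lift k (genAct k m T) b := by
    intro a b h
    obtain rfl : b = 0 := by cases h <;> rfl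
    have h0 : RingQuot.mkAlgHom k (CRel k m) a = 0 := by
      rw [RingQuot.mkAlgHom_rel k h, map_zero]
    rw [map_zero]
    refine LinearMap.prod_ext (LinearMap.ext fun b => ?_) (LinearMap.ext_ring ?_)
    · simp [lift_genAct_inl, h0]
    · simpa using hT a h
  let Φ : Calg k m →ₐ[k] Module.End k (M × k) :=
    RingQuot.liftAlgHom k ⟨FreeAlgebra.lift k (genAct k m T), hrel⟩
  have hΦ (a) : Φ (RingQuot.mkAlgHom k (CRel k m) a) = FreeAlgebra.lift k (genAct k m T) a :=
    RingQuot.liftAlgHom_mkAlgHom_apply _ _ _ _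
  refine ⟨LinearMap.fst k M k ∘ₗ LinearMap.applyₗ (0, 1) ∘ₗ Φ.toLinearMap, fun a g => ?_⟩
  obtain ⟨a, rfl⟩ := RingQuot.mkAlgHom_surjective k (CRel k m) a
  rw [cgen, ← map_mul]
  simp [hΦ, lift_genAct_inl]

end GenAct

/-- The values `e₀, e₁, e₂` on the generators `s, t, u`, and zero on all the others. -/
def stuValue {m : ℕ} {M : Type} [Zero M] (e : Fin 3 → M) : CGen m → M
  | .s => e 0
  | .t => e 1
  | .u => e 2
  | _ => 0

theorem exists_linearMap_mul_stu {k : Type} [Field k] {m : ℕ} {M : Type} [AddCommGroup M]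
    [Module k M] [Module (Calg k m) M] [IsScalarTower k (Calg k m) M] (e : Fin 3 → M)
    (hp : cp k m • e 0 = cp k m • e 1) (hq : cq k m • e 1 = cq k m • e 2)
    (hr : cr k m • e 0 = cr k m • e 2) :
    ∃ D : Calg k m →ₗ[k] M, ∀ a, D (a * cs k m) = a • e 0 ∧ D (a * ct k m) = a • e 1 ∧
      D (a * cu k m) = a • e 2 := by
  obtain ⟨D, hD⟩ := exists_linearMap_mul_cgen (k := k) (stuValue (m := m) e) (by
    rw [cp] at hp
    rw [cq] at hq
    rw [cr] at hr
    intro a h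
    cases h <;> simp [stuValue, hp, hq, hr])
  exact ⟨D, fun a => ⟨hD a .s, hD a .t, hD a .u⟩⟩

theorem cgen_mul_eq_of_rel_s8 {k : Type} [Field k] {m : ℕ} {g h g' h' : CGen m}
    (H : CRel k m (ι k g * ι k h - ι k g' * ι k h') 0) :
    cgen k m g * cgen k m h = cgen k m g' * cgen k m h' := by
  have := RingQuot.mkAlgHom_rel k H
  rwa [map_sub, map_mul, map_mul, map_zero, sub_eq_zero] at this

/-- In the algebra `C`, the rows of `δ` generate the left
annihilator of the column vector `ε = (s, t, u)ᵗ`. -/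
theorem stmt8 (k : Type) [Field k] (m : ℕ) (hm : 5 ≤ m) :
    {d : Fin 3 → Calg k m | d 0 * cs k m + d 1 * ct k m + d 2 * cu k m = 0}
      = (Submodule.span (Calg k m)
          {![-cp k m, cp k m, 0], ![0, -cq k m, cq k m], ![-cr k m, 0, cr k m]} :
            Set (Fin 3 → Calg k m)) := by
  set S : Set (Fin 3 → Calg k m) :=
    {![-cp k m, cp k m, 0], ![0, -cq k m, cq k m], ![-cr k m, 0, cr k m]}
  have mul_neg_one' (a : Calg k m) : a * -1 = -a := mul_neg_one a
  have neg_mul' (a b : Calg k m) : -a * b = -(a * b) := neg_mul a b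
  ext d
  simp only [Set.mem_ofPred_eq, SetLike.mem_coe]
  constructor
  · intro h
    let N := Submodule.span (Calg k m) S
    let e : Fin 3 → (Fin 3 → Calg k m) ⧸ N := fun i => N.mkQ (Pi.single i 1)
    have key (c : Calg k m) (i j : Fin 3) (hc : c • (Pi.single j 1 - Pi.single i 1) ∈ S) :
        c • e i = c • e j := by
      refine ((Submodule.Quotient.eq N).2 ?_).symm
      rw [← smul_sub]
      exact Submodule.subset_span hc
    obtain ⟨D, hD⟩ := exists_linearMap_mul_stu (k := k) e
      (key _ _ _ (.inl <| by ext i; fin_cases i <;> simp [mul_neg_one']))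
      (key _ _ _ (.inr <| .inl <| by ext i; fin_cases i <;> simp [mul_neg_one']))
      (key _ _ _ (.inr <| .inr <| by
        rw [Set.mem_singleton_iff]; ext i; fin_cases i <;> simp [mul_neg_one']))
    have h1 := congrArg D h
    rw [map_add, map_add, (hD _).1, (hD _).2.1, (hD _).2.2, map_zero] at h1
    rw [← Submodule.Quotient.mk_eq_zero N, ← h1]
    change N.mkQ d = d 0 • N.mkQ _ + d 1 • N.mkQ _ + d 2 • N.mkQ _
    rw [← map_smul, ← map_smul, ← map_smul, ← map_add, ← map_add]
    congr 1
    ext i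
    fin_cases i <;> simp
  · have hp : cp k m * cs k m = cp k m * ct k m := cgen_mul_eq_of_rel_s8 .ps_pt
    have hq : cq k m * ct k m = cq k m * cu k m := cgen_mul_eq_of_rel_s8 .qt_qu
    have hr : cr k m * cs k m = cr k m * cu k m := cgen_mul_eq_of_rel_s8 .rs_ru
    intro h
    induction h using Submodule.span_induction with
    | mem x hx =>
      rcases hx with rfl | rfl | rfl <;> simp [neg_mul', hp, hq, hr]
    | zero => simp
    | add x y _ _ hx hy =>
      simp only [Pi.add_apply, add_mul]
      rw [← add_zero (0 : Calg k m)]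
      nth_rw 1 [← hx]
      rw [← hy]
      abel
    | smul a x _ hx =>
      simp only [Pi.smul_apply, smul_eq_mul, mul_assoc, ← mul_add, hx, mul_zero]
end
end

section
/- In the algebra C (with m ≥ 7), for every i with 2 ≤ i ≤ m−5, the rows of χ_i generate the left annihilator of χ_{i+1}: the set {(e₁,e₂) ∈ C² : e₁x_{i+1} + e₂y_{i+1} = 0 and e₂z_{i+1} = 0} equals the left C-submodule of C² generated by the two vectors (x_i, 0) and (y_i, z_i). -/
noncomputable section

open FreeAlgebra

/-- The values on generators of the Fox-type derivation sending `x_j` to `a`, `y_j` to `b` and every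
other generator to `0`. -/
def foxValue {m : ℕ} {M : Type} [Zero M] (j : ℕ) (a b : M) : CGen m → M
  | CGen.x l _ _ => if l = j then a else 0
  | CGen.y l _ _ => if l = j then b else 0
  | _ => 0

section Triangular

variable {k : Type} [Field k] {m : ℕ} {M : Type} [AddCommGroup M] [Module k M]
  [Module (Calg k m) M] [IsScalarTower k (Calg k m) M]

/-- The block triangular action of the free algebra on `M × k` in which a generator `g` sends
`(v, c)` to `(g • v + c • f g, 0)`. -/
def triangularRep (f : CGen m → M) : FreeAlgebra k (CGen m) →ₐ[k] Module.End k (M × k) :=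
  FreeAlgebra.lift k fun g =>
    LinearMap.inl k M k ∘ₗ
      (Algebra.lsmul k k M (cgen k m g)).coprod (LinearMap.toSpanSingleton k M (f g))

theorem triangularRep_ι (f : CGen m → M) (g : CGen m) (v : M × k) :
    triangularRep f (ι k g) v = (cgen k m g • v.1 + v.2 • f g, 0) := by
  simp [triangularRep]

theorem triangularRep_inl (f : CGen m → M) (a : FreeAlgebra k (CGen m)) (v : M) :
    triangularRep f a (v, 0) = (RingQuot.mkAlgHom k (CRel k m) a • v, 0) := by
  induction a using FreeAlgebra.induction generalizing v with
  | grade0 c => simp [Module.algebraMap_end_apply]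
  | grade1 g => simp [triangularRep_ι, cgen]
  | mul a b ha hb => simp [ha, hb, mul_smul]
  | add a b ha hb => simp [ha, hb, add_smul]

/-- A derivation that kills the defining relations detects linear dependencies among the
generators. -/
theorem smul_add_smul_eq_zero_of_mul_add_mul_eq_zero (f : CGen m → M)
    (hf : ∀ a b, CRel k m a b → triangularRep f a (0, 1) = triangularRep f b (0, 1))
    (g h : CGen m) (a b : Calg k m) (hab : a * cgen k m g + b * cgen k m h = 0) :
    a • f g + b • f h = 0 := by
  have hrel : ∀ ⦃a b⦄, CRel k m a b → triangularRep f a = triangularRep f b := by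
    intro a b hab
    ext v
    · simp [triangularRep_inl, RingQuot.mkAlgHom_rel k hab]
    · simp [triangularRep_inl, RingQuot.mkAlgHom_rel k hab]
    · simp [hf a b hab]
    · simp [hf a b hab]
  obtain ⟨a, rfl⟩ := RingQuot.mkAlgHom_surjective k (CRel k m) a
  obtain ⟨b, rfl⟩ := RingQuot.mkAlgHom_surjective k (CRel k m) b
  have key := congrArg (fun c => RingQuot.liftAlgHom k ⟨triangularRep f, hrel⟩ c (0, 1)) hab
  simpa [cgen, triangularRep_ι, triangularRep_inl] using key

end Triangular

theorem cgen_mul_eq_zero_of_rel {k : Type} [Field k] {m : ℕ} {g h : CGen m}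
    (hr : CRel k m (ι k g * ι k h) 0) : cgen k m g * cgen k m h = 0 := by
  simpa [cgen] using RingQuot.mkAlgHom_rel k hr

/-- In the algebra `C` (with `m ≥ 7`), for every `i` with
`2 ≤ i ≤ m−5`, the rows of `χ_i` generate the left annihilator of `χ_{i+1}`. -/
theorem stmt13 (k : Type) [Field k] (m : ℕ) (hm : 7 ≤ m) :
    ∀ (i : ℕ) (h1 : 2 ≤ i) (h2 : i ≤ m - 5),
      {e : Fin 2 → Calg k m |
          e 0 * cx k m (i + 1) (by omega) (by omega) +
            e 1 * cy k m (i + 1) (by omega) (by omega) = 0 ∧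
          e 1 * cz k m (i + 1) (by omega) (by omega) = 0}
        = (Submodule.span (Calg k m)
            {![cx k m i (by omega) (by omega), 0],
             ![cy k m i (by omega) (by omega), cz k m i (by omega) (by omega)]} :
              Set (Fin 2 → Calg k m)) := by
  intro i h1 h2
  have hxx := cgen_mul_eq_zero_of_rel (CRel.xx (k := k) (m := m) i (by omega) (by omega))
  have hzz := cgen_mul_eq_zero_of_rel (CRel.zz (k := k) (m := m) i (by omega) (by omega))
  have hyz : cy k m i (by omega) (by omega) * cx k m (i + 1) (by omega) (by omega) +
      cz k m i (by omega) (by omega) * cy k m (i + 1) (by omega) (by omega) = 0 := by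
    simpa [cx, cy, cz, cgen] using
      RingQuot.mkAlgHom_rel k (CRel.yx_zy (k := k) (m := m) (i + 1) (by omega) (by omega))
  set N : Submodule (Calg k m) (Fin 2 → Calg k m) := Submodule.span (Calg k m)
    {![cx k m i (by omega) (by omega), 0],
      ![cy k m i (by omega) (by omega), cz k m i (by omega) (by omega)]} with hN
  ext e
  simp only [Set.mem_ofPred_eq, SetLike.mem_coe]
  constructor
  · rintro ⟨he, -⟩
    have hx : cgen k m (CGen.x i (by omega) (by omega)) • N.mkQ ![1, 0] = 0 := by
      rw [← map_smul, Submodule.mkQ_apply, Submodule.Quotient.mk_eq_zero, hN]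
      exact Submodule.subset_span (by simp [cx])
    have hy : cgen k m (CGen.y i (by omega) (by omega)) • N.mkQ ![1, 0] +
        cgen k m (CGen.z i (by omega) (by omega)) • N.mkQ ![0, 1] = 0 := by
      rw [← map_smul, ← map_smul, ← map_add, Submodule.mkQ_apply,
        Submodule.Quotient.mk_eq_zero, hN]
      exact Submodule.subset_span (by simp [cy, cz])
    have key := smul_add_smul_eq_zero_of_mul_add_mul_eq_zero
      (foxValue (i + 1) (N.mkQ ![1, 0]) (N.mkQ ![0, 1])) ?_ _ _ _ _ he
    · simp only [foxValue, if_true] at key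
      rw [← map_smul, ← map_smul, ← map_add, Submodule.mkQ_apply,
        Submodule.Quotient.mk_eq_zero] at key
      convert key using 1
      ext l
      fin_cases l <;> simp
    · intro a b hab
      cases hab with
      | xx l _ _ =>
        by_cases hl : l = i
        · subst hl
          simpa [triangularRep_ι, foxValue] using hx
        · simp [triangularRep_ι, foxValue, hl]
      | yx_zy l _ _ =>
        by_cases hl : l = i + 1
        · subst hl
          simpa [triangularRep_ι, foxValue] using hy
        · simp [triangularRep_ι, foxValue, hl]
      | _ => simp [triangularRep_ι, foxValue, show i ≠ 0 by omega, show 2 ≠ i + 1 by omega]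
  · intro he
    obtain ⟨a, b, rfl⟩ := Submodule.mem_span_pair.mp he
    constructor
    · have h := congrArg₂ (a * · + b * ·) hxx hyz
      simpa [add_mul, mul_add, mul_assoc, add_assoc, cx] using h
    · simp [mul_assoc, cz, hzz]
end
end
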